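/- Let $U \in \mathbb{R}^{n \times n}$ be orthogonal, $\lambda_1, \dots, \lambda_n \in \mathbb{R}$, $h, g : \mathbb{R} \to \mathbb{R}$, scales $s_1, \dots, s_J > 0$, and let $\Psi \in \mathbb{R}^{(1+J)n \times n}$ be the vertical stack of $\Psi_0 = U\,\mathrm{diag}(h(\lambda_i))\,U^\top$ and $\Psi_{s_j} = U\,\mathrm{diag}(g(s_j\lambda_i))\,U^\top$. If $h^2(\lambda_i) + \sum_{j=1}^{J} g^2(s_j\lambda_i) \neq 0$ for every $i = 1, \dots, n$, then the pseudoinverse $(\Psi^\top \Psi)^{-1}\Psi^\top$ is a left inverse of $\Psi$: for every $f \in \mathbb{R}^n$, $(\Psi^\top \Psi)^{-1}\Psi^\top (\Psi f) = f$; i.e., every signal can be exactly recovered from its scaling and wavelet function coefficients. -/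

import Mathlib

open Matrix BigOperators

/-- The Gram matrix of a vertical stack of the spectral filters `U * diagonal (d a) * Uᵀ` is the
spectral filter whose multiplier is the sum of the squared multipliers. -/
theorem transpose_mul_self_of_stacked_filters {ι m R : Type*} [Fintype ι] [Fintype m]
    [DecidableEq m] [CommRing R] {U : Matrix m m R} (hU : Uᵀ * U = 1) (d : ι → m → R)
    {P : Matrix (ι × m) m R}
    (hP : ∀ a i k, P (a, i) k = (U * diagonal (d a) * Uᵀ) i k) :
    Pᵀ * P = U * diagonal (fun i => ∑ a, d a i ^ 2) * Uᵀ := by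
  have hsum : Pᵀ * P =
      ∑ a, (U * diagonal (d a) * Uᵀ)ᵀ * (U * diagonal (d a) * Uᵀ) := by
    ext i k
    simp only [Matrix.sum_apply, Matrix.mul_apply (M := Pᵀ), Fintype.sum_prod_type,
      transpose_apply, hP]
    simp only [Matrix.mul_apply (M := (_)ᵀ), transpose_apply]
  have hsq (a : ι) : (U * diagonal (d a) * Uᵀ)ᵀ * (U * diagonal (d a) * Uᵀ) =
      U * diagonal (fun i => d a i ^ 2) * Uᵀ := by
    calc
      _ = U * diagonal (d a) * (Uᵀ * U) * diagonal (d a) * Uᵀ := by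
        simp only [transpose_mul, transpose_transpose, diagonal_transpose, Matrix.mul_assoc]
      _ = _ := by
        rw [hU, Matrix.mul_one, Matrix.mul_assoc U, diagonal_mul_diagonal]
        simp only [sq]
  have hdiag : diagonal (fun i => ∑ a, d a i ^ 2) =
      ∑ a, diagonal (fun i => d a i ^ 2) := by
    ext i k
    by_cases hik : i = k <;> simp [Matrix.sum_apply, hik]
  rw [hsum, hdiag, Matrix.mul_sum, Matrix.sum_mul]
  exact Finset.sum_congr rfl fun a _ => hsq a

/-- Under the stable-recovery condition
`h²(λᵢ) + ∑ⱼ g²(sⱼλᵢ) ≠ 0`, the pseudoinverse `(Ψᵀ Ψ)⁻¹ Ψᵀ` is a left inverse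
of `Ψ`: every signal `f` is exactly recovered from its wavelet coefficients. -/
theorem stmt_11 (n J : ℕ) (U : Matrix (Fin n) (Fin n) ℝ)
    (hU : U * Uᵀ = 1) (hU' : Uᵀ * U = 1)
    (lam : Fin n → ℝ) (h g : ℝ → ℝ)
    (s : Fin J → ℝ) (hs : ∀ j, 0 < s j)
    (Psi : Matrix (Fin (J + 1) × Fin n) (Fin n) ℝ)
    (hPsi0 : ∀ i k, Psi (0, i) k =
      (U * Matrix.diagonal (fun m => h (lam m)) * Uᵀ) i k)
    (hPsij : ∀ (j : Fin J) i k, Psi (j.succ, i) k =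
      (U * Matrix.diagonal (fun m => g (s j * lam m)) * Uᵀ) i k)
    (hp : ∀ i, h (lam i) ^ 2 + ∑ j, g (s j * lam i) ^ 2 ≠ 0) :
    ∀ f : Fin n → ℝ,
      (Psiᵀ * Psi)⁻¹.mulVec (Psiᵀ.mulVec (Psi.mulVec f)) = f := by
  intro f
  have hgram : Psiᵀ * Psi =
      U * diagonal (fun i => h (lam i) ^ 2 + ∑ j, g (s j * lam i) ^ 2) * Uᵀ := by
    have hstack := transpose_mul_self_of_stacked_filters hU'
      (Fin.cons (fun i => h (lam i)) (fun j i => g (s j * lam i)) : Fin (J + 1) → Fin n → ℝ)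
      (P := Psi) (Fin.cases hPsi0 hPsij)
    simpa only [Fin.sum_univ_succ, Fin.cons_zero, Fin.cons_succ] using hstack
  have hunit : IsUnit (Psiᵀ * Psi) := by
    rw [hgram]
    refine ((IsUnit.of_mul_eq_one _ hU).mul ?_).mul (IsUnit.of_mul_eq_one _ hU')
    exact isUnit_diagonal.2 (Pi.isUnit_iff.2 fun i => (hp i).isUnit)
  rw [mulVec_mulVec f, mulVec_mulVec,
    nonsing_inv_mul _ ((isUnit_iff_isUnit_det _).1 hunit), one_mulVec]
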